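/- arXiv:1902.00945 — 3 statements merged into one kernel-verified Lean document; each statement's English description precedes it below -/
import Mathlib

section
/- For every integer k ≥ 1, the M-type polynomial M_{k+1} has exactly k+1 distinct real roots, all of which lie in the closed interval [−1,1], and both endpoints −1 and 1 are among these roots. -/
open intervalIntegral

/-- The Legendre polynomial `l_j(t) = (1/(2^j j!)) (d/dt)^j (t²−1)^j`. -/
noncomputable def legendreP (j : ℕ) (t : ℝ) : ℝ :=
  (1 / (2 ^ j * (Nat.factorial j : ℝ))) * iteratedDeriv j (fun x : ℝ => (x ^ 2 - 1) ^ j) t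

/-- The M-type polynomials: `M_0(t) = 1`, `M_1(t) = t`, and
    `M_{k+1}(t) = (1/(2^k k!)) (d/dt)^{k−1} (t²−1)^k` for `k ≥ 1`. -/
noncomputable def Mpoly : ℕ → ℝ → ℝ
  | 0, _ => 1
  | 1, t => t
  | (k + 2), t =>
      (1 / (2 ^ (k + 1) * (Nat.factorial (k + 1) : ℝ))) *
        iteratedDeriv k (fun x : ℝ => (x ^ 2 - 1) ^ (k + 1)) t

section

open Polynomial

/-- The iterated derivative of a real polynomial function is the polynomial iterated derivative. -/
theorem iteratedDeriv_eval_polynomial (p : ℝ[X]) (m : ℕ) :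
    iteratedDeriv m (fun x : ℝ => p.eval x) = fun x => (derivative^[m] p).eval x := by
  induction m with
  | zero => simp
  | succ m ih =>
    rw [iteratedDeriv_succ, ih, Function.iterate_succ_apply']
    ext x
    exact Polynomial.deriv _

/-- The roots of `p` in the open interval `(a, b)`. -/
noncomputable def rootsIoo (p : ℝ[X]) (a b : ℝ) : Finset ℝ :=
  {x ∈ p.roots.toFinset | x ∈ Set.Ioo a b}

theorem card_insert_insert_rootsIoo (p : ℝ[X]) {a b : ℝ} (hab : a < b) :
    (insert a (insert b (rootsIoo p a b))).card = (rootsIoo p a b).card + 2 := by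
  rw [Finset.card_insert_of_notMem, Finset.card_insert_of_notMem]
  · simp [rootsIoo]
  · simp [rootsIoo, hab.ne]

theorem insert_insert_rootsIoo_subset {p : ℝ[X]} (hp : p ≠ 0) {a b : ℝ}
    (ha : p.IsRoot a) (hb : p.IsRoot b) :
    insert a (insert b (rootsIoo p a b)) ⊆ p.roots.toFinset := by
  intro x hx
  simp only [rootsIoo, Finset.mem_insert, Finset.mem_filter] at hx
  rcases hx with rfl | rfl | hx
  · simpa [hp] using ha
  · simpa [hp] using hb
  · exact hx.1

theorem derivative_ne_zero_of_isRoot {p : ℝ[X]} (hp : p ≠ 0) {a : ℝ} (ha : p.IsRoot a) :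
    derivative p ≠ 0 := by
  intro h
  have hC := eq_C_of_derivative_eq_zero h
  rw [hC, IsRoot, eval_C] at ha
  exact hp (by rw [hC, ha, C_0])

/-- **Rolle's theorem** for polynomials vanishing at both ends of an interval. -/
theorem card_rootsIoo_lt_derivative {p : ℝ[X]} (hp : p ≠ 0) {a b : ℝ} (hab : a < b)
    (ha : p.IsRoot a) (hb : p.IsRoot b) :
    (rootsIoo p a b).card < (rootsIoo (derivative p) a b).card := by
  have hp' := derivative_ne_zero_of_isRoot hp ha
  have hsub := insert_insert_rootsIoo_subset hp ha hb
  have hIcc : ∀ x ∈ insert a (insert b (rootsIoo p a b)), x ∈ Set.Icc a b := by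
    intro x hx
    simp only [rootsIoo, Finset.mem_insert, Finset.mem_filter] at hx
    rcases hx with rfl | rfl | hx
    · exact ⟨le_rfl, hab.le⟩
    · exact ⟨hab.le, le_rfl⟩
    · exact Set.Ioo_subset_Icc_self hx.2
  have key := Finset.card_le_of_interleaved (s := insert a (insert b (rootsIoo p a b)))
    (t := rootsIoo (derivative p) a b) fun x hx y hy hxy _ => by
      have hx0 : p.eval x = 0 := isRoot_of_mem_roots (Multiset.mem_toFinset.1 (hsub hx))
      have hy0 : p.eval y = 0 := isRoot_of_mem_roots (Multiset.mem_toFinset.1 (hsub hy))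
      obtain ⟨z, hz, hz0⟩ := exists_deriv_eq_zero hxy p.continuousOn (hx0.trans hy0.symm)
      rw [p.deriv] at hz0
      refine ⟨z, ?_, hz⟩
      simp only [rootsIoo, Finset.mem_filter, Multiset.mem_toFinset]
      exact ⟨(mem_roots hp').2 hz0, (hIcc x hx).1.trans_lt hz.1, hz.2.trans_le (hIcc y hy).2⟩
  rw [card_insert_insert_rootsIoo p hab] at key
  omega

theorem isRoot_iterate_derivative_sq_sub_one_pow {m n : ℕ} (hmn : m < n) {a : ℝ}
    (ha : a ^ 2 = 1) : (derivative^[m] ((X ^ 2 - 1 : ℝ[X]) ^ n)).IsRoot a := by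
  have hdvd : (X ^ 2 - 1 : ℝ[X]) ^ (n - m) ∣ derivative^[m] ((X ^ 2 - 1 : ℝ[X]) ^ n) :=
    pow_sub_dvd_iterate_derivative_pow _ n m
  refine IsRoot.dvd ?_ hdvd
  simp [IsRoot, ha, Nat.sub_ne_zero_of_lt hmn]

theorem iterate_derivative_sq_sub_one_pow_ne_zero_and_le_card_rootsIoo {m n : ℕ} (hmn : m ≤ n) :
    derivative^[m] ((X ^ 2 - 1 : ℝ[X]) ^ n) ≠ 0 ∧
      m ≤ (rootsIoo (derivative^[m] ((X ^ 2 - 1 : ℝ[X]) ^ n)) (-1) 1).card := by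
  induction m with
  | zero =>
    refine ⟨pow_ne_zero _ ?_, Nat.zero_le _⟩
    exact (monic_X_pow_sub_C (1 : ℝ) two_ne_zero).ne_zero
  | succ m ih =>
    obtain ⟨hne, hcard⟩ := ih (Nat.le_of_succ_le hmn)
    have hl := isRoot_iterate_derivative_sq_sub_one_pow (a := -1) hmn (by norm_num)
    have hr := isRoot_iterate_derivative_sq_sub_one_pow (a := 1) hmn (by norm_num)
    rw [Function.iterate_succ_apply']
    exact ⟨derivative_ne_zero_of_isRoot hne hl,
      hcard.trans_lt (card_rootsIoo_lt_derivative hne (by norm_num) hl hr)⟩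

theorem Mpoly_add_two_eq_zero_iff (n : ℕ) (t : ℝ) :
    Mpoly (n + 2) t = 0 ↔ (derivative^[n] ((X ^ 2 - 1 : ℝ[X]) ^ (n + 1))).IsRoot t := by
  have h := congrFun (iteratedDeriv_eval_polynomial ((X ^ 2 - 1 : ℝ[X]) ^ (n + 1)) n) t
  simp only [eval_pow, eval_sub, eval_X, eval_one] at h
  rw [Mpoly, h, mul_eq_zero, or_iff_right (by positivity), IsRoot]

end

/-- For every integer `k ≥ 1`, the M-type polynomial `M_{k+1}` has exactly
`k+1` distinct real roots, all lying in `[−1,1]`, and `−1` and `1` are among them. -/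
theorem Mpoly_roots (k : ℕ) (hk : 1 ≤ k) :
    ∃ roots : Finset ℝ, roots.card = k + 1 ∧ (↑roots : Set ℝ) ⊆ Set.Icc (-1:ℝ) 1 ∧
      (-1:ℝ) ∈ roots ∧ (1:ℝ) ∈ roots ∧
      (∀ t : ℝ, Mpoly (k + 1) t = 0 ↔ t ∈ roots) := by
  obtain ⟨n, rfl⟩ := Nat.exists_eq_add_of_le' hk
  set p : Polynomial ℝ :=
    Polynomial.derivative^[n] ((Polynomial.X ^ 2 - 1 : Polynomial ℝ) ^ (n + 1)) with hp
  obtain ⟨hne, hcard⟩ :=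
    iterate_derivative_sq_sub_one_pow_ne_zero_and_le_card_rootsIoo (Nat.le_succ n)
  rw [← hp] at hne hcard
  have hl : p.IsRoot (-1) :=
    isRoot_iterate_derivative_sq_sub_one_pow (Nat.lt_succ_self n) (by norm_num)
  have hr : p.IsRoot 1 :=
    isRoot_iterate_derivative_sq_sub_one_pow (Nat.lt_succ_self n) (by norm_num)
  have hins := card_insert_insert_rootsIoo p (show (-1 : ℝ) < 1 by norm_num)
  have hsub := insert_insert_rootsIoo_subset hne hl hr
  have hle : p.roots.toFinset.card ≤ n + 2 := by
    have hdeg : ((Polynomial.X ^ 2 - 1 : Polynomial ℝ) ^ (n + 1)).natDegree ≤ (n + 1) * 2 :=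
      Polynomial.natDegree_pow_le_of_le _ (by compute_degree)
    have hder := Polynomial.natDegree_iterate_derivative
      ((Polynomial.X ^ 2 - 1 : Polynomial ℝ) ^ (n + 1)) n
    have hroots := (Multiset.toFinset_card_le p.roots).trans p.card_roots'
    rw [← hp] at hder
    omega
  have heq := Finset.eq_of_subset_of_card_le hsub (by omega)
  have hge := Finset.card_le_card hsub
  refine ⟨p.roots.toFinset, by omega, ?_, by simpa [hne] using hl, by simpa [hne] using hr, ?_⟩
  · intro x hx
    rw [← heq] at hx
    simp only [rootsIoo, Finset.coe_insert, Finset.coe_filter, Set.mem_insert_iff,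
      Set.mem_ofPred_eq] at hx
    rcases hx with rfl | rfl | hx
    · norm_num
    · norm_num
    · exact Set.Ioo_subset_Icc_self hx.2
  · intro t
    rw [Mpoly_add_two_eq_zero_iff, Multiset.mem_toFinset, Polynomial.mem_roots hne]
end

section
/- Let k ≥ 2 be an integer and let f be continuously differentiable on [−1,1]. Then the M-type projection remainder f − f_k is orthogonal on [−1,1] to every polynomial of degree at most k−2: ∫_{−1}^{1} (f(t) − f_k(t)) v(t) dt = 0 for every polynomial v with deg v ≤ k−2. -/
open intervalIntegral

/-- The M-type coefficients of `f` (with derivative `f'` on `[-1,1]`):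
    `b_0 = (f(1)+f(−1))/2`, `b_j = (j − 1/2) ∫_{−1}^{1} f'(t) l_{j−1}(t) dt` for `j ≥ 1`. -/
noncomputable def mcoeff (f f' : ℝ → ℝ) : ℕ → ℝ
  | 0 => (f 1 + f (-1)) / 2
  | (j + 1) => (((j : ℝ) + 1) - 1 / 2) * ∫ t in (-1:ℝ)..1, f' t * legendreP j t

/-- The degree-`k` M-type projection `f_k(t) = Σ_{j=0}^{k} b_j M_j(t)`. -/
noncomputable def mproj (f f' : ℝ → ℝ) (k : ℕ) (t : ℝ) : ℝ :=
  ∑ j ∈ Finset.range (k + 1), mcoeff f f' j * Mpoly j t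

open Polynomial in
/-- Polynomial differentiation computes iterated derivatives of polynomial functions. -/
theorem iteratedDeriv_polynomial_eval (p : ℝ[X]) (n : ℕ) :
    iteratedDeriv n (fun x => p.eval x) = fun x => (derivative^[n] p).eval x := by
  induction n with
  | zero => simp
  | succ n ih =>
    rw [iteratedDeriv_succ, ih, Function.iterate_succ_apply']
    ext x
    exact Polynomial.deriv _

open Polynomial in
/-- The Legendre polynomial as an element of `ℝ[X]`. -/
noncomputable def legendrePoly (j : ℕ) : ℝ[X] :=
  C (1 / (2 ^ j * (Nat.factorial j : ℝ))) * derivative^[j] ((X ^ 2 - 1) ^ j)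

open Polynomial in
/-- The M-type polynomial as an element of `ℝ[X]`. -/
noncomputable def mTypePoly : ℕ → ℝ[X]
  | 0 => 1
  | 1 => X
  | (k + 2) => C (1 / (2 ^ (k + 1) * (Nat.factorial (k + 1) : ℝ))) *
      derivative^[k] ((X ^ 2 - 1) ^ (k + 1))

open Polynomial in
theorem eval_legendrePoly (j : ℕ) (t : ℝ) : (legendrePoly j).eval t = legendreP j t := by
  have h := congrFun (iteratedDeriv_polynomial_eval ((X ^ 2 - 1) ^ j) j) t
  simp only [eval_pow, eval_sub, eval_X, eval_one] at h
  rw [legendreP, legendrePoly, h, eval_mul, eval_C]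

open Polynomial in
theorem eval_mTypePoly (j : ℕ) (t : ℝ) : (mTypePoly j).eval t = Mpoly j t := by
  match j with
  | 0 => simp [mTypePoly, Mpoly]
  | 1 => simp [mTypePoly, Mpoly]
  | k + 2 =>
    have h := congrFun (iteratedDeriv_polynomial_eval ((X ^ 2 - 1) ^ (k + 1)) k) t
    simp only [eval_pow, eval_sub, eval_X, eval_one] at h
    rw [Mpoly, mTypePoly, h, eval_mul, eval_C]

open Polynomial in
theorem derivative_mTypePoly_succ (j : ℕ) : derivative (mTypePoly (j + 1)) = legendrePoly j := by
  cases j with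
  | zero => simp [mTypePoly, legendrePoly]
  | succ j => rw [mTypePoly, legendrePoly, derivative_C_mul, Function.iterate_succ_apply']

open Polynomial in
theorem eval_iterate_derivative_X_sq_sub_one_pow {i n : ℕ} (h : i < n) {t : ℝ} (ht : t ^ 2 = 1) :
    (derivative^[i] ((X ^ 2 - 1 : ℝ[X]) ^ n)).eval t = 0 := by
  obtain ⟨q, hq⟩ := pow_sub_dvd_iterate_derivative_pow (X ^ 2 - 1 : ℝ[X]) n i
  rw [hq]
  simp [ht, Nat.sub_ne_zero_of_lt h]

theorem Mpoly_add_two_eq_zero (j : ℕ) {t : ℝ} (ht : t ^ 2 = 1) : Mpoly (j + 2) t = 0 := by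
  rw [← eval_mTypePoly, mTypePoly, Polynomial.eval_mul,
    eval_iterate_derivative_X_sq_sub_one_pow j.lt_succ_self ht, mul_zero]

open Polynomial in
theorem intervalIntegrable_eval (p : ℝ[X]) (a b : ℝ) :
    IntervalIntegrable (fun t => p.eval t) MeasureTheory.volume a b :=
  p.continuous.intervalIntegrable a b

open Polynomial in
/-- Repeated integration by parts in Rodrigues' formula. -/
theorem integral_iterate_derivative_X_sq_sub_one_pow_mul {i n : ℕ} (h : i ≤ n) (p : ℝ[X]) :
    ∫ t in (-1 : ℝ)..1, (derivative^[i] ((X ^ 2 - 1 : ℝ[X]) ^ n)).eval t * p.eval t =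
      (-1) ^ i * ∫ t in (-1 : ℝ)..1,
        ((X ^ 2 - 1 : ℝ[X]) ^ n).eval t * (derivative^[i] p).eval t := by
  induction i generalizing p with
  | zero => simp
  | succ i ih =>
    have key := integral_mul_deriv_eq_deriv_mul (a := -1) (b := 1)
      (fun x _ => (derivative^[i] ((X ^ 2 - 1 : ℝ[X]) ^ n)).hasDerivAt x)
      (fun x _ => p.hasDerivAt x)
      (intervalIntegrable_eval _ _ _) (intervalIntegrable_eval _ _ _)
    rw [eval_iterate_derivative_X_sq_sub_one_pow (by omega) (by norm_num),
      eval_iterate_derivative_X_sq_sub_one_pow (by omega) (by norm_num),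
      ih (by omega) (derivative p)] at key
    rw [Function.iterate_succ_apply', Function.iterate_succ_apply, pow_succ (-1 : ℝ)]
    linarith

open Polynomial in
theorem natDegree_X_sq_sub_one_pow (n : ℕ) : ((X ^ 2 - 1 : ℝ[X]) ^ n).natDegree = 2 * n := by
  rw [natDegree_pow, ← C_1, natDegree_X_pow_sub_C, mul_comm]

open Polynomial in
theorem coeff_X_sq_sub_one_pow (n : ℕ) : ((X ^ 2 - 1 : ℝ[X]) ^ n).coeff (2 * n) = 1 := by
  have h : ((X ^ 2 - 1 : ℝ[X]) ^ n).Monic := by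
    rw [← C_1]
    exact (monic_X_pow_sub_C 1 two_ne_zero).pow n
  rw [← natDegree_X_sq_sub_one_pow n]
  exact h

theorem natDegree_legendrePoly_le (n : ℕ) : (legendrePoly n).natDegree ≤ n := by
  refine (Polynomial.natDegree_C_mul_le _ _).trans
    ((Polynomial.natDegree_iterate_derivative _ _).trans ?_)
  rw [natDegree_X_sq_sub_one_pow]
  omega

theorem coeff_legendrePoly_ne_zero (n : ℕ) : (legendrePoly n).coeff n ≠ 0 := by
  rw [legendrePoly, Polynomial.coeff_C_mul, Polynomial.coeff_iterate_derivative, ← two_mul,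
    coeff_X_sq_sub_one_pow]
  have : Nat.descFactorial (2 * n) n ≠ 0 := by
    rw [Ne, Nat.descFactorial_eq_zero_iff_lt]
    omega
  simp [this, Nat.factorial_ne_zero]

open Polynomial in
theorem integral_legendrePoly_mul (n : ℕ) (p : ℝ[X]) :
    ∫ t in (-1 : ℝ)..1, (legendrePoly n).eval t * p.eval t =
      (1 / (2 ^ n * (Nat.factorial n : ℝ))) * ((-1) ^ n * ∫ t in (-1 : ℝ)..1,
        ((X ^ 2 - 1 : ℝ[X]) ^ n).eval t * (derivative^[n] p).eval t) := by
  rw [← integral_iterate_derivative_X_sq_sub_one_pow_mul le_rfl, ← integral_const_mul]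
  simp [legendrePoly, mul_assoc]

theorem integral_legendrePoly_mul_of_lt {m n : ℕ} (h : m < n) :
    ∫ t in (-1 : ℝ)..1, (legendrePoly n).eval t * (legendrePoly m).eval t = 0 := by
  rw [integral_legendrePoly_mul,
    Polynomial.iterate_derivative_eq_zero ((natDegree_legendrePoly_le m).trans_lt h)]
  simp

theorem integral_legendrePoly_mul_of_ne {m n : ℕ} (h : m ≠ n) :
    ∫ t in (-1 : ℝ)..1, (legendrePoly m).eval t * (legendrePoly n).eval t = 0 := by
  rcases h.lt_or_gt with h | h
  · simp_rw [mul_comm ((legendrePoly m).eval _)]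
    exact integral_legendrePoly_mul_of_lt h
  · exact integral_legendrePoly_mul_of_lt h

theorem integral_sq_sub_one_pow_succ (n : ℕ) :
    (2 * (n : ℝ) + 3) * ∫ t in (-1 : ℝ)..1, (t ^ 2 - 1) ^ (n + 1) =
      -(2 * ((n : ℝ) + 1)) * ∫ t in (-1 : ℝ)..1, (t ^ 2 - 1) ^ n := by
  have key := integral_eq_sub_of_hasDerivAt (a := -1) (b := 1)
    (f := fun t : ℝ => t * (t ^ 2 - 1) ^ (n + 1))
    (f' := fun t => (2 * n + 3) * (t ^ 2 - 1) ^ (n + 1) + 2 * (n + 1) * (t ^ 2 - 1) ^ n)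
    (fun t _ => by
      refine ((hasDerivAt_id' t).fun_mul
        ((((hasDerivAt_id' t).fun_pow 2).sub_const 1).fun_pow (n + 1))).congr_deriv ?_
      simp only [Nat.add_sub_cancel, pow_succ]
      push_cast
      ring)
    (Continuous.intervalIntegrable (by fun_prop) _ _)
  rw [integral_add (Continuous.intervalIntegrable (by fun_prop) _ _)
    (Continuous.intervalIntegrable (by fun_prop) _ _), integral_const_mul,
    integral_const_mul] at key
  norm_num at key
  linarith

theorem integral_sq_sub_one_pow (n : ℕ) :
    ∫ t in (-1 : ℝ)..1, (t ^ 2 - 1) ^ n =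
      (-1) ^ n * 2 ^ (2 * n + 1) * (Nat.factorial n : ℝ) ^ 2 / Nat.factorial (2 * n + 1) := by
  induction n with
  | zero => norm_num
  | succ n ih =>
    have h := integral_sq_sub_one_pow_succ n
    rw [ih] at h
    have h3 : (2 * n + 3 : ℝ) ≠ 0 := by positivity
    rw [← mul_right_inj' h3, h, show 2 * (n + 1) + 1 = 2 * n + 1 + 1 + 1 by ring,
      Nat.factorial_succ (2 * n + 1 + 1), Nat.factorial_succ (2 * n + 1), Nat.factorial_succ n]
    push_cast
    field_simp
    ring

theorem integral_legendrePoly_mul_self (n : ℕ) :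
    ∫ t in (-1 : ℝ)..1, (legendrePoly n).eval t * (legendrePoly n).eval t =
      1 / ((n : ℝ) + 1 / 2) := by
  open Polynomial in
  have h : derivative^[n] (legendrePoly n) =
      C (1 / (2 ^ n * (Nat.factorial n : ℝ)) * (Nat.factorial (2 * n) : ℝ)) := by
    rw [legendrePoly, iterate_derivative_C_mul, ← Function.iterate_add_apply, C_mul]
    congr 1
    rw [eq_C_of_natDegree_le_zero (p := derivative^[n + n] ((X ^ 2 - 1 : ℝ[X]) ^ n))
      ((natDegree_iterate_derivative _ _).trans (by rw [natDegree_X_sq_sub_one_pow]; omega)),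
      coeff_iterate_derivative, zero_add, ← two_mul, coeff_X_sq_sub_one_pow,
      Nat.descFactorial_self]
    simp
  rw [integral_legendrePoly_mul, h]
  simp only [Polynomial.eval_C, Polynomial.eval_pow, Polynomial.eval_sub, Polynomial.eval_X,
    Polynomial.eval_one]
  rw [integral_mul_const, integral_sq_sub_one_pow, Nat.factorial_succ]
  have hn : (2 * n + 1 : ℝ) ≠ 0 := by positivity
  push_cast
  field_simp
  rw [← pow_mul, mul_comm n 2, pow_mul]
  norm_num
  ring

open Polynomial in
/-- A continuous function orthogonal to the first `k` Legendre polynomials is orthogonal to every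
polynomial of degree less than `k`. -/
theorem integral_mul_eval_eq_zero_of_degree_lt {g : ℝ → ℝ}
    (hg : ContinuousOn g (Set.uIcc (-1) 1)) {k : ℕ}
    (h : ∀ i < k, ∫ t in (-1 : ℝ)..1, g t * (legendrePoly i).eval t = 0) (p : ℝ[X])
    (hp : p.degree < k) : ∫ t in (-1 : ℝ)..1, g t * p.eval t = 0 := by
  induction k generalizing p with
  | zero =>
    have : p = 0 := Polynomial.ext fun m => (degree_lt_iff_coeff_zero p 0).1 hp m m.zero_le
    simp [this]
  | succ k ih =>
    set c := p.coeff k / (legendrePoly k).coeff k with hc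
    have hq : (p - C c * legendrePoly k).degree < k := by
      rw [degree_lt_iff_coeff_zero]
      intro m hm
      rw [coeff_sub, coeff_C_mul]
      rcases hm.eq_or_lt with rfl | hm
      · rw [hc, div_mul_cancel₀ _ (coeff_legendrePoly_ne_zero _), sub_self]
      · rw [(degree_lt_iff_coeff_zero _ _).1 hp m hm,
          coeff_eq_zero_of_natDegree_lt ((natDegree_legendrePoly_le k).trans_lt hm)]
        simp
    have hInt (q : ℝ[X]) :
        IntervalIntegrable (fun t => g t * q.eval t) MeasureTheory.volume (-1) 1 :=
      (hg.mul q.continuous.continuousOn).intervalIntegrable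
    have hsplit (t : ℝ) : g t * p.eval t =
        g t * (p - C c * legendrePoly k).eval t + c * (g t * (legendrePoly k).eval t) := by
      simp only [eval_sub, eval_mul, eval_C]
      ring
    simp_rw [hsplit]
    rw [integral_add (hInt _) ((hInt _).const_mul c), integral_const_mul, h k k.lt_succ_self,
      ih (fun i hi => h i (hi.trans k.lt_succ_self)) _ hq, mul_zero, add_zero]

open Polynomial in
theorem exists_derivative_eq_of_degree_le {n : ℕ} (p : ℝ[X]) (hp : p.degree ≤ n) :
    ∃ q : ℝ[X], derivative q = p ∧ q.degree < (n + 2 : ℕ) := by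
  refine ⟨∑ i ∈ Finset.range (n + 1), monomial (i + 1) (p.coeff i / (i + 1)), ?_, ?_⟩
  · rw [derivative_sum]
    conv_rhs => rw [p.as_sum_range' (n + 1) (Nat.lt_succ_of_le (natDegree_le_of_degree_le hp))]
    refine Finset.sum_congr rfl fun i _ => ?_
    have : (i + 1 : ℝ) ≠ 0 := by positivity
    rw [derivative_monomial]
    push_cast
    rw [div_mul_cancel₀ _ this]
  · rw [degree_lt_iff_coeff_zero]
    intro m hm
    rw [finsetSum_coeff]
    refine Finset.sum_eq_zero fun i hi => coeff_monomial_of_ne _ ?_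
    have := Finset.mem_range.1 hi
    omega

theorem hasDerivAt_mproj (f f' : ℝ → ℝ) (k : ℕ) (t : ℝ) :
    HasDerivAt (mproj f f' k)
      (∑ j ∈ Finset.range k, mcoeff f f' (j + 1) * (legendrePoly j).eval t) t := by
  have h : mproj f f' k = fun t => mcoeff f f' 0 +
      ∑ j ∈ Finset.range k, mcoeff f f' (j + 1) * (mTypePoly (j + 1)).eval t := by
    ext t
    simp only [mproj, eval_mTypePoly]
    rw [Finset.sum_range_succ', add_comm]
    simp [Mpoly]
  rw [h]
  refine HasDerivAt.const_add _ (HasDerivAt.fun_sum fun j _ => HasDerivAt.const_mul _ ?_)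
  rw [← derivative_mTypePoly_succ]
  exact Polynomial.hasDerivAt _ t

theorem mproj_apply_of_sq_eq_one (f f' : ℝ → ℝ) (k : ℕ) {t : ℝ} (ht : t ^ 2 = 1) :
    mproj f f' (k + 1) t = mcoeff f f' 0 + mcoeff f f' 1 * t := by
  rw [mproj, Finset.sum_range_succ', Finset.sum_range_succ']
  simp only [Mpoly_add_two_eq_zero _ ht]
  simp [Mpoly]
  ring

theorem integral_deriv_sub_mul_legendrePoly {f f' : ℝ → ℝ} {k i : ℕ}
    (hf' : ContinuousOn f' (Set.uIcc (-1) 1)) (hi : i < k) :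
    ∫ t in (-1 : ℝ)..1,
      (f' t - ∑ j ∈ Finset.range k, mcoeff f f' (j + 1) * (legendrePoly j).eval t) *
        (legendrePoly i).eval t = 0 := by
  simp_rw [sub_mul, Finset.sum_mul, mul_assoc]
  have hInt (j : ℕ) : IntervalIntegrable (fun t => mcoeff f f' (j + 1) *
      ((legendrePoly j).eval t * (legendrePoly i).eval t)) MeasureTheory.volume (-1) 1 :=
    Continuous.intervalIntegrable (by fun_prop) _ _
  rw [integral_sub (hf'.fun_mul (legendrePoly i).continuous.continuousOn).intervalIntegrable
    (by simpa only [Finset.sum_fn] using IntervalIntegrable.sum _ fun j _ => hInt j),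
    integral_finsetSum fun j _ => hInt j]
  simp_rw [integral_const_mul]
  rw [Finset.sum_eq_single_of_mem i (Finset.mem_range.2 hi)
    fun j _ hj => by rw [integral_legendrePoly_mul_of_ne hj, mul_zero],
    integral_legendrePoly_mul_self, mcoeff]
  simp_rw [eval_legendrePoly]
  have : (i + 1 - 1 / 2 : ℝ) = i + 1 / 2 := by ring
  rw [this]
  have : (i + 1 / 2 : ℝ) ≠ 0 := by positivity
  rw [mul_right_comm, mul_one_div_cancel this, one_mul, sub_self]

/-- Let `k ≥ 2` and let `f` be continuously differentiable on `[−1,1]`.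
Then the M-type projection remainder `f − f_k` is orthogonal on `[−1,1]` to every
polynomial of degree at most `k−2`. -/
theorem mproj_remainder_orthogonal (k : ℕ) (hk : 2 ≤ k) (f f' : ℝ → ℝ)
    (hf : ∀ t ∈ Set.Icc (-1:ℝ) 1, HasDerivWithinAt f (f' t) (Set.Icc (-1:ℝ) 1) t)
    (hf' : ContinuousOn f' (Set.Icc (-1:ℝ) 1)) :
    ∀ v : Polynomial ℝ, v.degree ≤ ((k - 2 : ℕ) : WithBot ℕ) →
      ∫ t in (-1:ℝ)..1, (f t - mproj f f' k t) * v.eval t = 0 := by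
  intro v hv
  obtain ⟨V, rfl, hV⟩ := exists_derivative_eq_of_degree_le v hv
  rw [Nat.sub_add_cancel hk] at hV
  have hI : Set.uIcc (-1 : ℝ) 1 = Set.Icc (-1) 1 := Set.uIcc_of_le (by norm_num)
  rw [← hI] at hf hf'
  have hg : ContinuousOn (fun t => f' t - ∑ j ∈ Finset.range k,
      mcoeff f f' (j + 1) * (legendrePoly j).eval t) (Set.uIcc (-1) 1) :=
    hf'.sub (Continuous.continuousOn (by fun_prop))
  have hb1 : mcoeff f f' 1 = (f 1 - f (-1)) / 2 := by
    have hL (t : ℝ) : legendreP 0 t = 1 := by simp [legendreP]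
    have hfcont : ContinuousOn f (Set.Icc (-1) 1) := hI ▸ fun t ht => (hf t ht).continuousWithinAt
    simp only [mcoeff, hL, mul_one]
    rw [integral_eq_sub_of_hasDerivAt_of_le (by norm_num) hfcont
      (fun t ht => (hf t (hI ▸ Set.Ioo_subset_Icc_self ht)).hasDerivAt
        (hI ▸ Icc_mem_nhds ht.1 ht.2)) hf'.intervalIntegrable]
    norm_num
    ring
  obtain ⟨m, rfl⟩ : ∃ m, k = m + 1 := ⟨k - 1, by omega⟩
  have h1 : f 1 - mproj f f' (m + 1) 1 = 0 := by
    rw [mproj_apply_of_sq_eq_one _ _ _ (one_pow 2), hb1, mcoeff]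
    ring
  have h2 : f (-1) - mproj f f' (m + 1) (-1) = 0 := by
    rw [mproj_apply_of_sq_eq_one _ _ _ neg_one_sq, hb1, mcoeff]
    ring
  rw [integral_mul_deriv_eq_deriv_mul_of_hasDerivWithinAt
    (fun t ht => (hf t ht).fun_sub (hasDerivAt_mproj f f' (m + 1) t).hasDerivWithinAt)
    (fun t _ => (V.hasDerivAt t).hasDerivWithinAt) hg.intervalIntegrable
    (intervalIntegrable_eval _ _ _),
    integral_mul_eval_eq_zero_of_degree_lt hg
      (fun i hi => integral_deriv_sub_mul_legendrePoly hf' hi) V hV]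
  simp [h1, h2]
end

section
/- For all integers i, j ≥ 1 there exists a constant C (depending only on i and j) such that for every smooth (C^∞) function f on the square [−1,1]², the M-type coefficient satisfies |b_{i,j}| ≤ C ∬_{[−1,1]²} |∂_s^i ∂_t^j f(s,t)| ds dt. -/
open intervalIntegral

/-- The 2D M-type coefficients `b_{i,j}` of a function `f` on `[−1,1]²`. -/
noncomputable def mcoeff2 (f : ℝ → ℝ → ℝ) : ℕ → ℕ → ℝ
  | 0, 0 => (f (-1) (-1) + f (-1) 1 + f 1 (-1) + f 1 1) / 4
  | 0, (j + 1) => ((2 * ((j : ℝ) + 1) - 1) / 4) *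
      ∫ t in (-1:ℝ)..1, (deriv (f 1) t + deriv (f (-1)) t) * legendreP j t
  | (i + 1), 0 => ((2 * ((i : ℝ) + 1) - 1) / 4) *
      ∫ s in (-1:ℝ)..1,
        (deriv (fun x => f x 1) s + deriv (fun x => f x (-1)) s) * legendreP i s
  | (i + 1), (j + 1) => ((2 * ((i : ℝ) + 1) - 1) * (2 * ((j : ℝ) + 1) - 1) / 4) *
      ∫ s in (-1:ℝ)..1, ∫ t in (-1:ℝ)..1,
        deriv (fun x => deriv (f x) t) s * legendreP i s * legendreP j t

/-- The `Q^k` M-type projection `f_{k,k}(s,t) = Σ_{i=0}^{k} Σ_{j=0}^{k} b_{i,j} M_i(s) M_j(t)`. -/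
noncomputable def mproj2 (f : ℝ → ℝ → ℝ) (k : ℕ) (s t : ℝ) : ℝ :=
  ∑ i ∈ Finset.range (k + 1), ∑ j ∈ Finset.range (k + 1),
    mcoeff2 f i j * Mpoly i s * Mpoly j t

/-- The mixed partial derivative `∂_s^i ∂_t^j f (s,t)`. -/
noncomputable def pderiv2 (i j : ℕ) (f : ℝ → ℝ → ℝ) (s t : ℝ) : ℝ :=
  iteratedDeriv i (fun x => iteratedDeriv j (f x) t) s

/-- The seminorm `[f]_m = ( ∬ (∂_s^m f)² + ∬ (∂_t^m f)² )^{1/2}` on `[−1,1]²`. -/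
noncomputable def seminorm2 (m : ℕ) (f : ℝ → ℝ → ℝ) : ℝ :=
  Real.sqrt ((∫ s in (-1:ℝ)..1, ∫ t in (-1:ℝ)..1, (pderiv2 m 0 f s t) ^ 2) +
             (∫ s in (-1:ℝ)..1, ∫ t in (-1:ℝ)..1, (pderiv2 0 m f s t) ^ 2))

/-- The derivative of `F` in the direction `v`, as a function of the base point. -/
noncomputable def dirDeriv {E : Type*} [NormedAddCommGroup E] [NormedSpace ℝ E] (v : E)
    (F : E → ℝ) : E → ℝ :=
  fun p => fderiv ℝ F p v

section DirDeriv

variable {E : Type*} [NormedAddCommGroup E] [NormedSpace ℝ E] {F : E → ℝ}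

theorem contDiff_dirDeriv (hF : ContDiff ℝ (⊤ : ℕ∞) F) (v : E) :
    ContDiff ℝ (⊤ : ℕ∞) (dirDeriv v F) :=
  (hF.fderiv_right (m := (⊤ : ℕ∞)) (by simp)).clm_apply contDiff_const

theorem contDiff_dirDeriv_iterate (hF : ContDiff ℝ (⊤ : ℕ∞) F) (v : E) (n : ℕ) :
    ContDiff ℝ (⊤ : ℕ∞) ((dirDeriv v)^[n] F) := by
  induction n with
  | zero => exact hF
  | succ n ih =>
    rw [Function.iterate_succ_apply']
    exact contDiff_dirDeriv ih v

theorem dirDeriv_comm (hF : ContDiff ℝ (⊤ : ℕ∞) F) (v w : E) :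
    dirDeriv v (dirDeriv w F) = dirDeriv w (dirDeriv v F) := by
  have hd : Differentiable ℝ (fderiv ℝ F) :=
    (hF.fderiv_right (m := (⊤ : ℕ∞)) (by simp)).differentiable (by simp)
  have key : ∀ (a b p : E), dirDeriv a (dirDeriv b F) p = fderiv ℝ (fderiv ℝ F) p a b := by
    intro a b p
    have := ((hd p).hasFDerivAt.clm_apply (hasFDerivAt_const b p)).fderiv
    change fderiv ℝ (fun q => fderiv ℝ F q b) p a = _
    rw [this]
    simp
  funext p
  rw [key, key]
  refine (hF.contDiffAt.isSymmSndFDerivAt ?_) v w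
  rw [minSmoothness_of_isRCLikeNormedField]
  exact WithTop.coe_le_coe.2 (le_top : (2 : ℕ∞) ≤ ⊤)

theorem dirDeriv_iterate_comm (hF : ContDiff ℝ (⊤ : ℕ∞) F) (v w : E) (n : ℕ) :
    (dirDeriv w)^[n] (dirDeriv v F) = dirDeriv v ((dirDeriv w)^[n] F) := by
  induction n with
  | zero => rfl
  | succ n ih =>
    rw [Function.iterate_succ_apply', Function.iterate_succ_apply', ih,
      dirDeriv_comm (contDiff_dirDeriv_iterate hF w n)]

end DirDeriv

section Slices

variable {F : ℝ × ℝ → ℝ}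

theorem deriv_slice_fst (hF : ContDiff ℝ (⊤ : ℕ∞) F) (t : ℝ) :
    deriv (fun x => F (x, t)) = fun s => dirDeriv (1, 0) F (s, t) := by
  funext s
  have h1 : HasFDerivAt F (fderiv ℝ F (s, t)) (s, t) :=
    (hF.differentiable (by simp) _).hasFDerivAt
  have h2 : HasDerivAt (fun x : ℝ => (x, t)) ((1 : ℝ), (0 : ℝ)) s :=
    (hasDerivAt_id s).prodMk (hasDerivAt_const s t)
  exact (h1.comp_hasDerivAt s h2).deriv

theorem deriv_slice_snd (hF : ContDiff ℝ (⊤ : ℕ∞) F) (s : ℝ) :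
    deriv (fun y => F (s, y)) = fun t => dirDeriv (0, 1) F (s, t) := by
  funext t
  have h1 : HasFDerivAt F (fderiv ℝ F (s, t)) (s, t) :=
    (hF.differentiable (by simp) _).hasFDerivAt
  have h2 : HasDerivAt (fun y : ℝ => (s, y)) ((0 : ℝ), (1 : ℝ)) t :=
    (hasDerivAt_const t s).prodMk (hasDerivAt_id t)
  exact (h1.comp_hasDerivAt t h2).deriv

theorem iteratedDeriv_slice_fst (hF : ContDiff ℝ (⊤ : ℕ∞) F) (n : ℕ) (t : ℝ) :
    iteratedDeriv n (fun x => F (x, t)) = fun s => (dirDeriv (1, 0))^[n] F (s, t) := by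
  induction n with
  | zero => simp
  | succ n ih =>
    rw [iteratedDeriv_succ, ih, deriv_slice_fst (contDiff_dirDeriv_iterate hF _ n),
      Function.iterate_succ_apply']

theorem iteratedDeriv_slice_snd (hF : ContDiff ℝ (⊤ : ℕ∞) F) (n : ℕ) (s : ℝ) :
    iteratedDeriv n (fun y => F (s, y)) = fun t => (dirDeriv (0, 1))^[n] F (s, t) := by
  induction n with
  | zero => simp
  | succ n ih =>
    rw [iteratedDeriv_succ, ih, deriv_slice_snd (contDiff_dirDeriv_iterate hF _ n),
      Function.iterate_succ_apply']

theorem pderiv2_eq_dirDeriv {f : ℝ → ℝ → ℝ}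
    (hf : ContDiff ℝ (⊤ : ℕ∞) (Function.uncurry f)) (i j : ℕ) (s t : ℝ) :
    pderiv2 i j f s t =
      (dirDeriv (1, 0))^[i] ((dirDeriv (0, 1))^[j] (Function.uncurry f)) (s, t) := by
  have h : (fun x => iteratedDeriv j (f x) t) =
      fun x => (dirDeriv (0, 1))^[j] (Function.uncurry f) (x, t) :=
    funext fun x => congrFun (iteratedDeriv_slice_snd hf j x) t
  rw [pderiv2, h, iteratedDeriv_slice_fst (contDiff_dirDeriv_iterate hf _ j)]

end Slices

theorem exists_iteratedDeriv_sq_sub_one_pow (n : ℕ) : ∀ m : ℕ, ∃ p : Polynomial ℝ,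
    iteratedDeriv n (fun x : ℝ => (x ^ 2 - 1) ^ (n + m)) =
      fun x => (x ^ 2 - 1) ^ m * p.eval x := by
  induction n with
  | zero => exact fun m => ⟨1, by simp⟩
  | succ n ih =>
    intro m
    obtain ⟨p, hp⟩ := ih (m + 1)
    refine ⟨Polynomial.C ((m : ℝ) + 1) * (2 * Polynomial.X) * p +
      (Polynomial.X ^ 2 - 1) * Polynomial.derivative p, ?_⟩
    rw [iteratedDeriv_succ, show n + 1 + m = n + (m + 1) by ring, hp]
    funext x
    have h := ((((hasDerivAt_id x).pow 2).sub_const 1).pow (m + 1)).mul (p.hasDerivAt x)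
    refine h.deriv.trans ?_
    simp
    ring

theorem contDiff_sq_sub_one_pow (k : ℕ) :
    ContDiff ℝ (⊤ : ℕ∞) (fun x : ℝ => (x ^ 2 - 1) ^ k) := by
  fun_prop

theorem continuous_legendreP (k : ℕ) : Continuous (legendreP k) :=
  continuous_const.mul ((contDiff_sq_sub_one_pow k).continuous_iteratedDeriv k (by exact_mod_cast le_top))

theorem integral_mul_iteratedDeriv_sq_sub_one_pow {n k : ℕ} (hn : n ≤ k) :
    ∀ {g : ℝ → ℝ}, ContDiff ℝ (⊤ : ℕ∞) g →
      ∫ x in (-1:ℝ)..1, g x * iteratedDeriv n (fun x : ℝ => (x ^ 2 - 1) ^ k) x =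
        (-1) ^ n * ∫ x in (-1:ℝ)..1, iteratedDeriv n g x * (x ^ 2 - 1) ^ k := by
  induction n with
  | zero => intro g _; simp
  | succ n ih =>
    intro g hg
    have hg' : ContDiff ℝ (⊤ : ℕ∞) (deriv g) := (contDiff_infty_iff_deriv.1 hg).2
    have hφ := contDiff_sq_sub_one_pow k
    obtain ⟨m, rfl⟩ : ∃ m, k = n + (m + 1) := ⟨k - n - 1, by omega⟩
    obtain ⟨p, hp⟩ := exists_iteratedDeriv_sq_sub_one_pow n (m + 1)
    have hparts := integral_mul_deriv_eq_deriv_mul (a := -1) (b := 1) (u := g) (u' := deriv g)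
      (v := iteratedDeriv n (fun x : ℝ => (x ^ 2 - 1) ^ (n + (m + 1))))
      (v' := iteratedDeriv (n + 1) (fun x : ℝ => (x ^ 2 - 1) ^ (n + (m + 1))))
      (fun x _ => (hg.differentiable (by simp) x).hasDerivAt)
      (fun x _ => by
        rw [iteratedDeriv_succ]
        exact ((hφ.differentiable_iteratedDeriv n
          (by exact_mod_cast WithTop.coe_lt_top _)) x).hasDerivAt)
      (hg'.continuous.intervalIntegrable _ _)
      ((hφ.continuous_iteratedDeriv (n + 1) (by exact_mod_cast le_top)).intervalIntegrable _ _)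
    rw [hparts, ih (by omega) hg', hp, iteratedDeriv_succ']
    simp [pow_succ]

/-- Integrating a smooth function against a Legendre polynomial by repeated integration by parts. -/
theorem integral_mul_legendreP (k : ℕ) {g : ℝ → ℝ} (hg : ContDiff ℝ (⊤ : ℕ∞) g) :
    ∫ x in (-1:ℝ)..1, g x * legendreP k x =
      (1 / (2 ^ k * (Nat.factorial k : ℝ)) * (-1) ^ k) *
        ∫ x in (-1:ℝ)..1, iteratedDeriv k g x * (x ^ 2 - 1) ^ k := by
  simp only [legendreP, mul_left_comm (g _)]
  rw [integral_const_mul, integral_mul_iteratedDeriv_sq_sub_one_pow le_rfl hg, mul_assoc]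

theorem integral_swap_of_continuous {f : ℝ → ℝ → ℝ} (hf : Continuous (Function.uncurry f))
    (a b c d : ℝ) :
    ∫ s in a..b, ∫ t in c..d, f s t = ∫ t in c..d, ∫ s in a..b, f s t := by
  refine MeasureTheory.intervalIntegral_intervalIntegral_swap ?_
  exact (hf.continuousOn.integrableOn_compact (isCompact_uIcc.prod isCompact_uIcc)).mono_set
    (Set.prod_mono Set.uIoc_subset_uIcc Set.uIoc_subset_uIcc)

theorem integral_mul_legendreP_mul_legendreP (i j : ℕ) {F : ℝ × ℝ → ℝ}
    (hF : ContDiff ℝ (⊤ : ℕ∞) F) :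
    ∫ s in (-1:ℝ)..1, ∫ t in (-1:ℝ)..1, F (s, t) * legendreP i s * legendreP j t =
      (1 / (2 ^ i * (Nat.factorial i : ℝ)) * (-1) ^ i) *
        (1 / (2 ^ j * (Nat.factorial j : ℝ)) * (-1) ^ j) *
        ∫ s in (-1:ℝ)..1, ∫ t in (-1:ℝ)..1,
          (dirDeriv (1, 0))^[i] ((dirDeriv (0, 1))^[j] F) (s, t) *
            (s ^ 2 - 1) ^ i * (t ^ 2 - 1) ^ j := by
  have hG := contDiff_dirDeriv_iterate hF (0, 1) j
  set G := (dirDeriv (0, 1))^[j] F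
  have hH := contDiff_dirDeriv_iterate hG (1, 0) i
  set H := (dirDeriv (1, 0))^[i] G
  have hl := continuous_legendreP i
  have hGc := hG.continuous
  have hHc := hH.continuous
  set ci := 1 / (2 ^ i * (Nat.factorial i : ℝ)) * (-1) ^ i
  set cj := 1 / (2 ^ j * (Nat.factorial j : ℝ)) * (-1) ^ j
  have inner_t : ∀ s : ℝ, ∫ t in (-1:ℝ)..1, F (s, t) * legendreP i s * legendreP j t =
      cj * ∫ t in (-1:ℝ)..1, G (s, t) * legendreP i s * (t ^ 2 - 1) ^ j := by
    intro s
    have h := integral_mul_legendreP j (g := fun t => F (s, t)) (by fun_prop)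
    rw [iteratedDeriv_slice_snd hF] at h
    simp only [mul_right_comm _ (legendreP i s)]
    rw [integral_mul_const, integral_mul_const, h]
    ring
  have inner_s : ∀ t : ℝ, ∫ s in (-1:ℝ)..1, G (s, t) * legendreP i s * (t ^ 2 - 1) ^ j =
      ci * ∫ s in (-1:ℝ)..1, H (s, t) * (s ^ 2 - 1) ^ i * (t ^ 2 - 1) ^ j := by
    intro t
    have h := integral_mul_legendreP i (g := fun s => G (s, t)) (by fun_prop)
    rw [iteratedDeriv_slice_fst hG] at h
    rw [integral_mul_const, integral_mul_const, h]
    ring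
  simp only [inner_t]
  rw [integral_const_mul, integral_swap_of_continuous (by fun_prop)]
  simp only [inner_s]
  rw [integral_const_mul, integral_swap_of_continuous (by fun_prop)]
  ring

theorem abs_sq_sub_one_pow_le_one {x : ℝ} (hx : x ∈ Set.Icc (-1:ℝ) 1) (k : ℕ) :
    |(x ^ 2 - 1) ^ k| ≤ 1 := by
  rw [abs_pow]
  refine pow_le_one₀ (abs_nonneg _) (abs_le.2 ⟨?_, ?_⟩) <;> nlinarith [hx.1, hx.2]

theorem abs_integral_mul_sq_sub_one_pow_le (i j : ℕ) {H : ℝ × ℝ → ℝ} (hH : Continuous H) :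
    |∫ s in (-1:ℝ)..1, ∫ t in (-1:ℝ)..1, H (s, t) * (s ^ 2 - 1) ^ i * (t ^ 2 - 1) ^ j| ≤
      ∫ s in (-1:ℝ)..1, ∫ t in (-1:ℝ)..1, |H (s, t)| := by
  have hle : (-1:ℝ) ≤ 1 := by norm_num
  refine (abs_integral_le_integral_abs hle).trans (integral_mono_on hle ?_ ?_ fun s hs => ?_)
  · exact Continuous.intervalIntegrable (by fun_prop) _ _
  · exact Continuous.intervalIntegrable (by fun_prop) _ _
  refine (abs_integral_le_integral_abs hle).trans (integral_mono_on hle ?_ ?_ fun t ht => ?_)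
  · exact Continuous.intervalIntegrable (by fun_prop) _ _
  · exact Continuous.intervalIntegrable (by fun_prop) _ _
  rw [abs_mul, abs_mul, mul_assoc]
  exact mul_le_of_le_one_right (abs_nonneg _)
    (mul_le_one₀ (abs_sq_sub_one_pow_le_one hs i) (abs_nonneg _)
      (abs_sq_sub_one_pow_le_one ht j))

theorem mcoeff2_succ_succ (i j : ℕ) {f : ℝ → ℝ → ℝ}
    (hf : ContDiff ℝ (⊤ : ℕ∞) (Function.uncurry f)) :
    mcoeff2 f (i + 1) (j + 1) =
      ((2 * ((i : ℝ) + 1) - 1) * (2 * ((j : ℝ) + 1) - 1) / 4) *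
        ((1 / (2 ^ i * (Nat.factorial i : ℝ)) * (-1) ^ i) *
          (1 / (2 ^ j * (Nat.factorial j : ℝ)) * (-1) ^ j)) *
        ∫ s in (-1:ℝ)..1, ∫ t in (-1:ℝ)..1,
          pderiv2 (i + 1) (j + 1) f s t * (s ^ 2 - 1) ^ i * (t ^ 2 - 1) ^ j := by
  have hmixed : ∀ s t : ℝ, deriv (fun x => deriv (f x) t) s =
      dirDeriv (1, 0) (dirDeriv (0, 1) (Function.uncurry f)) (s, t) := by
    intro s t
    simpa [pderiv2] using pderiv2_eq_dirDeriv hf 1 1 s t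
  have hf' := contDiff_dirDeriv hf (0, 1)
  simp only [mcoeff2, hmixed, pderiv2_eq_dirDeriv hf]
  rw [integral_mul_legendreP_mul_legendreP i j (contDiff_dirDeriv hf' (1, 0)),
    dirDeriv_iterate_comm hf']
  simp only [Function.iterate_succ_apply]
  ring

/-- For all integers `i, j ≥ 1` there exists a constant `C` (depending only
on `i` and `j`) such that for every smooth `f` on `[−1,1]²`,
`|b_{i,j}| ≤ C ∬_{[−1,1]²} |∂_s^i ∂_t^j f(s,t)| ds dt`. -/
theorem mcoeff2_bound (i j : ℕ) (hi : 1 ≤ i) (hj : 1 ≤ j) :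
    ∃ C : ℝ, 0 < C ∧ ∀ f : ℝ → ℝ → ℝ, ContDiff ℝ (⊤ : ℕ∞) (Function.uncurry f) →
      |mcoeff2 f i j| ≤
        C * ∫ s in (-1:ℝ)..1, ∫ t in (-1:ℝ)..1, |pderiv2 i j f s t| := by
  obtain ⟨i, rfl⟩ := Nat.exists_eq_add_of_le' hi
  obtain ⟨j, rfl⟩ := Nat.exists_eq_add_of_le' hj
  have hi' : 0 < 2 * ((i : ℝ) + 1) - 1 := by linarith [i.cast_nonneg (α := ℝ)]
  have hj' : 0 < 2 * ((j : ℝ) + 1) - 1 := by linarith [j.cast_nonneg (α := ℝ)]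
  refine ⟨|((2 * ((i : ℝ) + 1) - 1) * (2 * ((j : ℝ) + 1) - 1) / 4) *
    ((1 / (2 ^ i * (Nat.factorial i : ℝ)) * (-1) ^ i) *
      (1 / (2 ^ j * (Nat.factorial j : ℝ)) * (-1) ^ j))|,
    abs_pos.2 (by positivity), fun f hf => ?_⟩
  rw [mcoeff2_succ_succ i j hf, abs_mul]
  refine mul_le_mul_of_nonneg_left ?_ (abs_nonneg _)
  simp only [pderiv2_eq_dirDeriv hf]
  exact abs_integral_mul_sq_sub_one_pow_le i j
    (contDiff_dirDeriv_iterate (contDiff_dirDeriv_iterate hf _ _) _ _).continuous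
end
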